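/- Let Φ: Ũ_R → Ũ_R be a continuous self-map of the set Ũ_R = {ũ: Ω_h → ℝ³ : ‖ũ‖_{Ω_h} ≤ R, ũ|_{∂Ω_h} = 0}, which is a compact convex subset of a finite-dimensional vector space. Then Φ has a fixed point. In particular, the time-1 map of the discrete Navier–Stokes equations with 1-periodic forcing, which maps Ũ_R to itself for R ≥ R₀(Ω,f) and is continuous, has a fixed point, yielding a time-periodic discrete solution. -/

import Mathlib

open Finset Real

/-- Lattice points of the grid (indices; the physical point is `h • x`). -/
abbrev Pt := Fin 3 → ℤ

/-- Standard basis vector of the lattice. -/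
def ee (i : Fin 3) : Pt := fun j => if j = i then 1 else 0

/-- Central difference `D_i φ(x) = (φ(x+he^i) - φ(x-he^i))/(2h)`. -/
noncomputable def Dc (h : ℝ) (i : Fin 3) (φ : Pt → ℝ) (x : Pt) : ℝ :=
  (φ (x + ee i) - φ (x - ee i)) / (2 * h)

/-- Forward difference `D_i⁺ φ(x) = (φ(x+he^i) - φ(x))/h`. -/
noncomputable def Dp (h : ℝ) (i : Fin 3) (φ : Pt → ℝ) (x : Pt) : ℝ :=
  (φ (x + ee i) - φ x) / h

/-- Second difference `D_i² φ(x) = (φ(x+he^i)+φ(x-he^i)-2φ(x))/h²`. -/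
noncomputable def D2 (h : ℝ) (i : Fin 3) (φ : Pt → ℝ) (x : Pt) : ℝ :=
  (φ (x + ee i) + φ (x - ee i) - 2 * φ x) / h ^ 2

/-- Central-difference divergence `𝒟·u`. -/
noncomputable def divc (h : ℝ) (u : Pt → Fin 3 → ℝ) (x : Pt) : ℝ :=
  ∑ i, Dc h i (fun y => u y i) x

open scoped Classical in
/-- Discrete boundary `∂Ω_h = {x ∈ Ω_h : {x ± he^i} ⊄ Ω_h}`. -/
noncomputable def bdry (Ω : Finset Pt) : Finset Pt :=
  Ω.filter (fun x => ∃ i : Fin 3, x + ee i ∉ Ω ∨ x - ee i ∉ Ω)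

/-- Parity class (one of the eight classes G¹,…,G⁸) of a grid point. -/
def parity (x : Pt) : Fin 3 → ZMod 2 := fun i => (x i : ZMod 2)

open scoped Classical in
/-- The interior sub-grid `Ω_h^∘`. -/
noncomputable def circInt (Ω : Finset Pt) : Finset Pt :=
  (Ω \ bdry Ω).filter
    (fun x => ∀ a : Fin 3 → ℤ, (∀ i, 0 ≤ a i ∧ a i ≤ 2) → x + a ∈ Ω \ bdry Ω)

open scoped Classical in
/-- The parity class `Ω_h^{∘j}` of the interior sub-grid. -/
noncomputable def circJ (Ω : Finset Pt) (p : Fin 3 → ZMod 2) : Finset Pt :=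
  (circInt Ω).filter (fun x => parity x = p)

namespace BrouwerAux

open Metric MeasureTheory Polynomial
open scoped NNReal Topology Manifold ContDiff

set_option linter.unusedSectionVars false

section
variable {E : Type*} [NormedAddCommGroup E] [InnerProductSpace ℝ E] [FiniteDimensional ℝ E]

lemma det_poly (A : E →L[ℝ] E) : ∃ p : ℝ[X], p.natDegree ≤ Module.finrank ℝ E ∧
    ∀ t : ℝ, p.eval t = (1 + t • A : E →L[ℝ] E).det := by
  let b := Module.finBasis ℝ E
  let M := LinearMap.toMatrix b b (A : E →ₗ[ℝ] E)
  refine ⟨Matrix.det ((X : ℝ[X]) • M.map C + (1 : Matrix _ _ ℝ).map C), ?_, ?_⟩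
  · simpa using Polynomial.natDegree_det_X_add_C_le M 1
  · intro t
    rw [← Polynomial.coe_evalRingHom, RingHom.map_det]
    rw [ContinuousLinearMap.det, ← LinearMap.det_toMatrix b]
    congr 1
    ext i j
    by_cases hij : i = j
    · simp [hij, M, LinearMap.toMatrix_apply]
      ring
    · simp [hij, M, LinearMap.toMatrix_apply]
      ring

lemma ker_of_det_zero (A : E →L[ℝ] E) (h : A.det = 0) : ∃ v, v ≠ 0 ∧ A v = 0 := by
  have := LinearMap.bot_lt_ker_of_det_eq_zero (f := (A : E →ₗ[ℝ] E)) h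
  obtain ⟨v, hv, h0⟩ := Submodule.exists_mem_ne_zero_of_ne_bot this.ne'
  exact ⟨v, h0, by simpa using hv⟩

lemma det_pos (A : E →L[ℝ] E) (t : ℝ) (ht : 0 ≤ t) (h : t * ‖A‖ < 1) :
    0 < (1 + t • A : E →L[ℝ] E).det := by
  by_contra! hle
  have hc : Continuous fun s : ℝ => (1 + s • A : E →L[ℝ] E).det :=
    ContinuousLinearMap.continuous_det.comp (by fun_prop)
  have h0 : (1 + (0:ℝ) • A : E →L[ℝ] E).det = 1 := by
    simp [ContinuousLinearMap.det]
  obtain ⟨s, hs, hs0⟩ := intermediate_value_Icc' ht hc.continuousOn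
    (show (0:ℝ) ∈ _ from ⟨hle, by simp only [h0]; norm_num⟩)
  obtain ⟨v, hv, hv0⟩ := ker_of_det_zero _ hs0
  have h1 : v = -(s • A v) := by
    have : v + s • A v = 0 := by simpa using hv0
    exact eq_neg_of_add_eq_zero_left this
  have h2 : ‖v‖ ≤ s * (‖A‖ * ‖v‖) := by
    calc ‖v‖ = ‖-(s • A v)‖ := by rw [← h1]
      _ = s * ‖A v‖ := by rw [norm_neg, norm_smul, Real.norm_of_nonneg hs.1]
      _ ≤ _ := by gcongr; exact hs.1; exact A.le_opNorm v
  have h3 : 0 < ‖v‖ := norm_pos_iff.2 hv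
  have h4 : s * ‖A‖ ≤ t * ‖A‖ := by gcongr; exact hs.2
  nlinarith

lemma lip_extend (g : E → E) (K : ℝ≥0) (hg : LipschitzOnWith K g (closedBall 0 1))
    (h0 : ∀ x, ‖x‖ = 1 → g x = 0) (G : E → E) (hG1 : ∀ x ∈ ball (0:E) 1, G x = g x)
    (hG0 : ∀ x ∉ ball (0:E) 1, G x = 0) : LipschitzWith (2 * K) G := by
  have key : ∀ x ∈ ball (0:E) 1, ∀ y ∉ ball (0:E) 1, ‖G x‖ ≤ 2 * K * ‖x - y‖ := by
    intro x hx y hy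
    have hx' : ‖x‖ < 1 := by simpa using hx
    have hy' : 1 ≤ ‖y‖ := by simpa using hy
    have hz : ‖(‖y‖⁻¹ • y)‖ = 1 := by
      rw [norm_smul, norm_inv, norm_norm, inv_mul_cancel₀]; positivity
    have h1 := hg.dist_le_mul x (ball_subset_closedBall hx) (‖y‖⁻¹ • y) (by simp [hz])
    rw [h0 _ hz, dist_zero_right, ← hG1 x hx, dist_eq_norm] at h1
    have h2 : ‖y - ‖y‖⁻¹ • y‖ = ‖y‖ - 1 := by
      have : y - ‖y‖⁻¹ • y = (1 - ‖y‖⁻¹) • y := by rw [sub_smul, one_smul]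
      rw [this, norm_smul, Real.norm_of_nonneg (by
        rw [sub_nonneg]; exact inv_le_one_of_one_le₀ hy'), sub_mul, inv_mul_cancel₀ (by positivity),
        one_mul]
    have h3 : ‖x - ‖y‖⁻¹ • y‖ ≤ ‖x - y‖ + ‖y - ‖y‖⁻¹ • y‖ := norm_sub_le_norm_sub_add_norm_sub _ _ _
    have h4 : ‖y‖ - ‖x‖ ≤ ‖x - y‖ := by rw [norm_sub_rev]; exact norm_sub_norm_le _ _
    calc ‖G x‖ ≤ K * ‖x - ‖y‖⁻¹ • y‖ := h1
      _ ≤ K * (2 * ‖x - y‖) := by gcongr; linarith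
      _ = _ := by ring
  refine LipschitzWith.of_dist_le_mul fun x y => ?_
  rw [dist_eq_norm, dist_eq_norm]
  push_cast
  by_cases hx : x ∈ ball (0:E) 1 <;> by_cases hy : y ∈ ball (0:E) 1
  · have := hg.dist_le_mul x (ball_subset_closedBall hx) y (ball_subset_closedBall hy)
    rw [hG1 x hx, hG1 y hy]
    rw [dist_eq_norm, dist_eq_norm] at this
    have : 0 ≤ K * ‖x - y‖ := by positivity
    linarith
  · rw [hG0 y hy, sub_zero]; exact key x hx y hy
  · rw [hG0 x hx, zero_sub, norm_neg, norm_sub_rev]; exact key y hy x hx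
  · rw [hG0 x hx, hG0 y hy, sub_zero, norm_zero]; positivity

lemma image_ball (G : E → E) (K : ℝ≥0) (hG : LipschitzWith K G)
    (hG0 : ∀ x ∉ ball (0:E) 1, G x = 0) (t : ℝ) (ht : 0 ≤ t) (htK : t * K < 1) :
    Function.Injective (fun x => x + t • G x) ∧
      (fun x => x + t • G x) '' ball 0 1 = ball 0 1 := by
  have hinj : Function.Injective (fun x => x + t • G x) := by
    intro x y hxy
    simp only at hxy
    by_contra hne
    have h1 : x - y = t • (G y - G x) := by
      rw [smul_sub]; rw [sub_eq_sub_iff_add_eq_add]; rw [hxy]; abel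
    have h2 : ‖x - y‖ = t * ‖G y - G x‖ := by
      conv_lhs => rw [h1]
      rw [norm_smul, Real.norm_of_nonneg ht]
    have h3 := hG.dist_le_mul y x
    rw [dist_eq_norm, dist_eq_norm, norm_sub_rev y x] at h3
    have h4 : 0 < ‖x - y‖ := norm_pos_iff.2 (sub_ne_zero.2 hne)
    have h5 : t * ‖G y - G x‖ ≤ t * (K * ‖x - y‖) := by gcongr
    nlinarith
  refine ⟨hinj, ?_⟩
  ext y
  constructor
  · rintro ⟨x, hx, rfl⟩
    by_contra hy
    have : x = x + t • G x := by
      apply hinj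
      simp only
      simp only at hy
      rw [hG0 _ hy]; simp
    simp only [← this] at hy
    exact hy hx
  · intro hy
    have hc : ContractingWith (Real.toNNReal t * K) (fun x => y - t • G x) := by
      refine ⟨by rw [← NNReal.coe_lt_coe]; simpa [ht] using htK, ?_⟩
      refine LipschitzWith.of_dist_le_mul fun a b => ?_
      have := hG.dist_le_mul a b
      rw [dist_sub_left, dist_smul₀, Real.norm_of_nonneg ht]
      rw [NNReal.coe_mul, Real.coe_toNNReal t ht, mul_assoc]
      exact mul_le_mul_of_nonneg_left this ht
    have hx := hc.fixedPoint_isFixedPt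
    set x := ContractingWith.fixedPoint _ hc
    have hx' : x + t • G x = y := by
      have : y - t • G x = x := hx
      exact (sub_eq_iff_eq_add.1 this).symm
    refine ⟨x, ?_, hx'⟩
    by_contra hxb
    rw [hG0 x hxb, smul_zero, add_zero] at hx'
    exact hxb (hx' ▸ hy)


lemma det_zero_of_sphere (f : E → E) (f' : E →L[ℝ] E) (x : E) (hx : x ∈ ball (0:E) 1)
    (hf : HasFDerivAt f f' x) (h1 : ∀ y ∈ ball (0:E) 1, ‖f y‖ = 1) : f'.det = 0 := by
  have h2 : HasFDerivAt (fun y => inner ℝ (f y) (f y)) (0 : E →L[ℝ] ℝ) x := by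
    refine (hasFDerivAt_const (1:ℝ) x).congr_of_eventuallyEq ?_
    filter_upwards [isOpen_ball.mem_nhds hx] with y hy
    rw [real_inner_self_eq_norm_sq, h1 y hy, one_pow]
  have h3 := (hf.inner ℝ hf).unique h2
  have h4 : ∀ v, inner ℝ (f x) (f' v) = 0 := by
    intro v
    have := congrArg (fun L : E →L[ℝ] ℝ => L v) h3
    simp [real_inner_comm] at this
    exact this
  by_contra hne
  have hu : IsUnit (f' : E →ₗ[ℝ] E) :=
    (LinearMap.isUnit_iff_isUnit_det _).2 (isUnit_iff_ne_zero.2 hne)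
  have hs : Function.Surjective f' := ((Module.End.isUnit_iff _).1 hu).2
  obtain ⟨v, hv⟩ := hs (f x)
  have h5 := h4 v
  rw [hv, real_inner_self_eq_norm_sq, h1 x hx] at h5
  norm_num at h5

variable [MeasurableSpace E] [BorelSpace E]

lemma no_retraction (f : E → E) (hf : ∀ x ∈ closedBall (0:E) 1, ContDiffAt ℝ 1 f x)
    (h1 : ∀ x ∈ closedBall (0:E) 1, ‖f x‖ = 1) (h2 : ∀ x, ‖x‖ = 1 → f x = x) : False := by
  classical
  let g : E → E := fun x => f x - x
  have hg : ∀ x ∈ closedBall (0:E) 1, ContDiffAt ℝ 1 g x := fun x hx =>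
    (hf x hx).sub contDiffAt_id
  have hloc : LocallyLipschitzOn (closedBall (0:E) 1) g := by
    intro x hx
    obtain ⟨K, t, ht, h⟩ := (hg x hx).exists_lipschitzOnWith
    exact ⟨K, t, mem_nhdsWithin_of_mem_nhds ht, h⟩
  obtain ⟨K0, hK0⟩ := hloc.exists_lipschitzOnWith_of_compact (isCompact_closedBall 0 1)
  let G : E → E := fun x => if x ∈ ball (0:E) 1 then g x else 0
  have hG1 : ∀ x ∈ ball (0:E) 1, G x = g x := fun x hx => if_pos hx
  have hG0 : ∀ x ∉ ball (0:E) 1, G x = 0 := fun x hx => if_neg hx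
  have hGL := lip_extend g K0 hK0 (fun x hx => by simp [g, h2 x hx]) G hG1 hG0
  set K : ℝ≥0 := 2 * K0
  let A : E → (E →L[ℝ] E) := fun x => fderiv ℝ f x - 1
  have hfd : ∀ x ∈ ball (0:E) 1, HasFDerivAt f (fderiv ℝ f x) x := fun x hx =>
    ((hf x (ball_subset_closedBall hx)).differentiableAt (by norm_num)).hasFDerivAt
  have hGd : ∀ x ∈ ball (0:E) 1, HasFDerivAt G (A x) x := by
    intro x hx
    have : HasFDerivAt g (A x) x := (hfd x hx).sub (hasFDerivAt_id x)
    refine this.congr_of_eventuallyEq ?_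
    filter_upwards [isOpen_ball.mem_nhds hx] with y hy using hG1 y hy
  have hAn : ∀ x ∈ ball (0:E) 1, ‖A x‖ ≤ K := by
    intro x hx
    rw [← (hGd x hx).fderiv]
    exact norm_fderiv_le_of_lipschitz ℝ hGL
  have hAc : ContinuousOn A (closedBall (0:E) 1) := by
    intro x hx
    have : ContinuousAt (fderiv ℝ f) x :=
      ((hf x hx).fderiv_right (m := 0) (by norm_num)).continuousAt
    exact (this.sub continuousAt_const).continuousWithinAt
  have hintegr : ∀ t : ℝ, IntegrableOn (fun x => (1 + t • A x : E →L[ℝ] E).det) (ball (0:E) 1) := by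
    intro t
    have : ContinuousOn (fun x => (1 + t • A x : E →L[ℝ] E).det) (closedBall (0:E) 1) :=
      ContinuousLinearMap.continuous_det.comp_continuousOn
        (continuousOn_const.add (hAc.const_smul t))
    exact (this.integrableOn_compact (isCompact_closedBall 0 1)).mono_set ball_subset_closedBall
  have hvol : ∀ t : ℝ, 0 ≤ t → t * K < 1 →
      ∫ x in ball (0:E) 1, (1 + t • A x : E →L[ℝ] E).det = volume.real (ball (0:E) 1) := by
    intro t ht htK
    obtain ⟨hinj, him⟩ := image_ball G K hGL hG0 t ht htK
    have := integral_image_eq_integral_abs_det_fderiv_smul volume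
      (measurableSet_ball (x := (0:E)) (ε := 1)) (f := fun x => x + t • G x)
      (f' := fun x => 1 + t • A x)
      (fun x hx => ((hasFDerivAt_id x).add ((hGd x hx).const_smul t)).hasFDerivWithinAt)
      hinj.injOn (fun _ => (1:ℝ))
    rw [him] at this
    simp only [integral_const, smul_eq_mul, mul_one, measureReal_restrict_apply_univ] at this
    rw [this]
    refine setIntegral_congr_fun measurableSet_ball fun x hx => ?_
    refine (abs_of_pos (det_pos _ t ht ?_)).symm
    exact lt_of_le_of_lt (mul_le_mul_of_nonneg_left (hAn x hx) ht) htK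
  -- interpolation nodes
  let n := Module.finrank ℝ E
  let s := Finset.range (n + 1)
  let v : ℕ → ℝ := fun j => (((K : ℝ) + 1) * (j + 1))⁻¹
  have hKpos : (0:ℝ) < K + 1 := by positivity
  have hv0 : ∀ j, 0 ≤ v j := fun j => by positivity
  have hvK : ∀ j, v j * K < 1 := by
    intro j
    simp only [v]
    rw [inv_mul_lt_iff₀ (by positivity)]
    have : (0:ℝ) ≤ K * j := by positivity
    have : (0:ℝ) ≤ j := by positivity
    nlinarith
  have hvi : Set.InjOn v s := by
    intro a _ b _ hab
    have h := inv_injective hab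
    have h' := mul_left_cancel₀ hKpos.ne' h
    exact_mod_cast add_right_cancel h'
  let w : ℕ → ℝ := fun j => (Lagrange.basis s v j).eval 1
  have hw : ∑ j ∈ s, w j = 1 := by
    have := congrArg (Polynomial.eval (1:ℝ)) (Lagrange.sum_basis hvi ⟨0, by simp [s]⟩)
    simpa [Polynomial.eval_finsetSum] using this
  have hdet : ∀ B : E →L[ℝ] E, (1 + (1:ℝ) • B : E →L[ℝ] E).det =
      ∑ j ∈ s, (1 + v j • B : E →L[ℝ] E).det * w j := by
    intro B
    obtain ⟨p, hp, hpe⟩ := det_poly B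
    have hd : p.degree < s.card := by
      refine lt_of_le_of_lt Polynomial.degree_le_natDegree ?_
      simp only [s, Finset.card_range]
      exact_mod_cast Nat.lt_succ_of_le hp
    have := congrArg (Polynomial.eval (1:ℝ)) (Lagrange.eq_interpolate hvi hd)
    rw [hpe, Lagrange.interpolate_apply, Polynomial.eval_finsetSum] at this
    rw [this]
    refine Finset.sum_congr rfl fun j _ => ?_
    rw [Polynomial.eval_mul, Polynomial.eval_C, hpe]
  have hzero : ∀ x ∈ ball (0:E) 1, (1 + (1:ℝ) • A x : E →L[ℝ] E).det = 0 := by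
    intro x hx
    have : (1 + (1:ℝ) • A x : E →L[ℝ] E) = fderiv ℝ f x := by simp [A]
    rw [this]
    exact det_zero_of_sphere f _ x hx (hfd x hx) fun y hy => h1 y (ball_subset_closedBall hy)
  have hI : ∫ x in ball (0:E) 1, (1 + (1:ℝ) • A x : E →L[ℝ] E).det = 0 := by
    rw [setIntegral_congr_fun measurableSet_ball hzero]; simp
  simp_rw [hdet] at hI
  rw [integral_finsetSum _ fun j _ => (hintegr (v j)).mul_const (w j)] at hI
  simp_rw [integral_mul_const, hvol _ (hv0 _) (hvK _), ← Finset.mul_sum, hw, mul_one] at hI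
  have hpos : 0 < volume.real (ball (0:E) 1) :=
    ENNReal.toReal_pos (measure_ball_pos _ _ one_pos).ne' measure_ball_lt_top.ne
  exact hpos.ne' hI

/-- A smooth self-map with values in the unit ball has a fixed point. -/
lemma smooth_fixed (p : E → E) (hp : ContDiff ℝ 1 p) (hb : ∀ x, ‖p x‖ ≤ 1) : ∃ x, p x = x := by
  by_contra! hne
  let v : E → E := fun x => x - p x
  let a : E → ℝ := fun x => inner ℝ (v x) (v x)
  let b : E → ℝ := fun x => inner ℝ x (v x)
  let c : E → ℝ := fun x => 1 - inner ℝ x x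
  let d : E → ℝ := fun x => b x ^ 2 + a x * c x
  have hv : ContDiff ℝ 1 v := contDiff_id.sub hp
  have ha : ContDiff ℝ 1 a := hv.inner ℝ hv
  have hbb : ContDiff ℝ 1 b := contDiff_id.inner ℝ hv
  have hc : ContDiff ℝ 1 c := contDiff_const.sub (contDiff_id.inner ℝ contDiff_id)
  have hd : ContDiff ℝ 1 d := (hbb.pow 2).add (ha.mul hc)
  have hv0 : ∀ x, v x ≠ 0 := fun x => sub_ne_zero.2 (hne x).symm
  have ha0 : ∀ x, 0 < a x := fun x => real_inner_self_pos.2 (hv0 x)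
  have hbpos : ∀ x, ‖x‖ = 1 → 0 < b x := by
    intro x hx
    have h1 : a x = inner ℝ x x - 2 * inner ℝ x (p x) + inner ℝ (p x) (p x) := by
      simp only [a, v, inner_sub_left, inner_sub_right, real_inner_comm (p x) x]; ring
    have h2 : b x = inner ℝ x x - inner ℝ x (p x) := by simp only [b, v, inner_sub_right]
    have h3 := ha0 x
    rw [h1] at h3
    rw [h2]
    rw [real_inner_self_eq_norm_sq, real_inner_self_eq_norm_sq, hx] at h3
    rw [real_inner_self_eq_norm_sq, hx]
    have h4 := hb x
    have h5 : ‖p x‖ ^ 2 ≤ 1 := pow_le_one₀ (norm_nonneg _) h4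
    linarith
  have hc0 : ∀ x, ‖x‖ = 1 → c x = 0 := by
    intro x hx
    simp only [c]; rw [real_inner_self_eq_norm_sq, hx]; norm_num
  have hdpos : ∀ x ∈ closedBall (0:E) 1, 0 < d x := by
    intro x hx
    have hx' : ‖x‖ ≤ 1 := by simpa using hx
    rcases hx'.lt_or_eq with h | h
    · have : 0 < c x := by
        simp only [c]; rw [real_inner_self_eq_norm_sq]
        have := norm_nonneg x
        nlinarith
      have := mul_pos (ha0 x) this
      have := sq_nonneg (b x)
      simp only [d]; linarith
    · simp only [d]
      rw [hc0 x h]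
      have := pow_pos (hbpos x h) 2
      linarith
  let l : E → ℝ := fun x => (-b x + Real.sqrt (d x)) / a x
  refine no_retraction (fun x => x + l x • v x) ?_ ?_ ?_
  · intro x hx
    have hs : ContDiffAt ℝ 1 (fun y => Real.sqrt (d y)) x := hd.contDiffAt.sqrt (hdpos x hx).ne'
    have hl : ContDiffAt ℝ 1 l x :=
      (hbb.contDiffAt.neg.add hs).div ha.contDiffAt (ha0 x).ne'
    exact contDiffAt_id.add (hl.smul hv.contDiffAt)
  · intro x hx
    have hq : l x * a x = -b x + Real.sqrt (d x) := div_mul_cancel₀ _ (ha0 x).ne'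
    have hs := Real.sq_sqrt (hdpos x hx).le
    have hexp : ‖x + l x • v x‖ ^ 2 = inner ℝ x x + 2 * l x * b x + l x ^ 2 * a x := by
      rw [← real_inner_self_eq_norm_sq]
      simp only [a, b, inner_add_left, inner_add_right, inner_smul_left, inner_smul_right,
        real_inner_comm x (v x), conj_trivial]
      ring
    have h1 : a x * (‖x + l x • v x‖ ^ 2 - 1) = 0 := by
      rw [hexp]
      have hdd : d x = b x ^ 2 + a x * (1 - inner ℝ x x) := rfl
      have : (l x * a x + b x) ^ 2 = d x := by
        rw [hq, neg_add_cancel_comm]; exact hs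
      nlinarith
    have h2 : ‖x + l x • v x‖ ^ 2 = 1 := by
      rcases mul_eq_zero.1 h1 with h | h
      · exact absurd h (ha0 x).ne'
      · linarith
    exact (pow_eq_one_iff_of_nonneg (norm_nonneg _) two_ne_zero).1 h2
  · intro x hx
    have : l x = 0 := by
      simp only [l, d]
      rw [hc0 x hx, mul_zero, add_zero, Real.sqrt_sq (hbpos x hx).le]; simp
    simp [this]

lemma cont_fixed (f : E → E) (hf : Continuous f) (hb : ∀ x, ‖f x‖ ≤ 1) : ∃ x, f x = x := by
  by_contra! hne
  obtain ⟨g, hg⟩ := exists_contMDiffMap_forall_mem_convex_of_local_const (n := 1) 𝓘(ℝ, E)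
    (t := fun y => closedBall (0:E) 1 ∩ ball (f y) ‖f y - y‖)
    (fun y => (convex_closedBall _ _).inter (convex_ball _ _))
    (by
      intro x
      refine ⟨f x, ?_⟩
      have h1 : ∀ᶠ y in 𝓝 x, ‖f x - f y‖ < ‖f y - y‖ := by
        refine ContinuousAt.eventually_lt (by fun_prop) (by fun_prop) ?_
        simpa [sub_eq_zero] using hne x
      filter_upwards [h1] with y hy
      exact ⟨by simpa using hb x, by simpa [dist_eq_norm] using hy⟩)
  obtain ⟨x, hx⟩ := smooth_fixed g g.contMDiff.contDiff (fun x => by simpa using (hg x).1)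
  have := (hg x).2
  rw [hx, mem_ball, dist_eq_norm, norm_sub_rev] at this
  exact lt_irrefl _ this

/-- Brouwer's fixed point theorem on a closed ball centred at the origin. -/
theorem brouwer (r : ℝ) (hr : 0 ≤ r) (f : E → E) (hf : ContinuousOn f (closedBall 0 r))
    (hm : Set.MapsTo f (closedBall 0 r) (closedBall 0 r)) : ∃ x ∈ closedBall (0:E) r, f x = x := by
  rcases hr.eq_or_lt with rfl | hr
  · refine ⟨0, by simp, ?_⟩
    have := hm (show (0:E) ∈ closedBall (0:E) 0 by simp)
    simpa using this
  let P : E → E := fun x => (r / max 1 ‖x‖) • x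
  have hmax : ∀ x : E, (0:ℝ) < max 1 ‖x‖ := fun x => lt_max_of_lt_left one_pos
  have hPc : Continuous P := by
    refine Continuous.smul (continuous_const.div (by fun_prop) fun x => (hmax x).ne') continuous_id
  have hPb : ∀ x, P x ∈ closedBall (0:E) r := by
    intro x
    rw [mem_closedBall_zero_iff, norm_smul, norm_div, Real.norm_of_nonneg hr.le,
      Real.norm_of_nonneg (hmax x).le, div_mul_eq_mul_div, div_le_iff₀ (hmax x)]
    exact mul_le_mul_of_nonneg_left (le_max_right _ _) hr.le
  have hP : ∀ x, ‖x‖ ≤ 1 → P x = r • x := by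
    intro x hx
    simp only [P, max_eq_left hx, div_one]
  have hbd : ∀ x, ‖r⁻¹ • f (P x)‖ ≤ 1 := by
    intro x
    have : ‖f (P x)‖ ≤ r := by simpa using hm (hPb x)
    rw [norm_smul, norm_inv, Real.norm_of_nonneg hr.le, inv_mul_le_iff₀ hr, mul_one]
    exact this
  obtain ⟨x, hx⟩ := cont_fixed (fun x => r⁻¹ • f (P x))
    ((hf.comp_continuous hPc hPb).const_smul _) hbd
  have hx1 : ‖x‖ ≤ 1 := by rw [← hx]; exact hbd x
  refine ⟨P x, hPb x, ?_⟩
  rw [hP x hx1] at hx ⊢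
  exact (inv_smul_eq_iff₀ hr.ne').1 hx

end
end BrouwerAux

/-- **Fixed point of the time-1 map** (Theorem 4.2, via Brouwer): any continuous
self-map `Φ` of the compact convex set
`Ũ_R = {ũ : Ω_h → ℝ³ : ‖ũ‖_{Ω_h} ≤ R, ũ|_{∂Ω_h} = 0}` (a subset of the
finite-dimensional space of grid functions) has a fixed point; in particular the
time-1 map of the discrete Navier–Stokes equations with 1-periodic forcing has a
fixed point, yielding a time-periodic discrete solution. -/
theorem time_one_map_fixed_point (h R : ℝ) (hh : 0 < h) (hR : 0 ≤ R)
    (Ω : Finset Pt)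
    (Φ : ({ x // x ∈ Ω } → Fin 3 → ℝ) → ({ x // x ∈ Ω } → Fin 3 → ℝ))
    (U : Set ({ x // x ∈ Ω } → Fin 3 → ℝ))
    (hU : U = { u | Real.sqrt (∑ x : { x // x ∈ Ω }, (∑ i, (u x i) ^ 2) * h ^ 3) ≤ R
        ∧ ∀ x : { x // x ∈ Ω }, (x : Pt) ∈ bdry Ω → u x = 0 })
    (hcont : ContinuousOn Φ U) (hmaps : Set.MapsTo Φ U U) :
    ∃ u ∈ U, Φ u = u := by
  classical
  let T : EuclideanSpace ℝ ({ x // x ∈ Ω } × Fin 3) → ({ x // x ∈ Ω } → Fin 3 → ℝ) := fun w x i => if (x : Pt) ∈ bdry Ω then 0 else w (x, i)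
  let S : ({ x // x ∈ Ω } → Fin 3 → ℝ) → EuclideanSpace ℝ ({ x // x ∈ Ω } × Fin 3) := fun u => WithLp.toLp 2 (fun p => u p.1 p.2)
  have hh3 : 0 < h ^ 3 := by positivity
  have hsq : 0 < Real.sqrt (h ^ 3) := Real.sqrt_pos.2 hh3
  have hTc : Continuous T := by
    refine continuous_pi fun x => continuous_pi fun i => ?_
    by_cases hx : (x : Pt) ∈ bdry Ω
    · simp only [T, hx, if_true]; exact continuous_const
    · simp only [T, hx, if_false]; fun_prop
  have hSc : Continuous S := by
    refine (PiLp.continuous_toLp 2 _).comp ?_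
    fun_prop
  have hnorm : ∀ u : { x // x ∈ Ω } → Fin 3 → ℝ,
      Real.sqrt (∑ x : { x // x ∈ Ω }, (∑ i, (u x i) ^ 2) * h ^ 3)
        = ‖S u‖ * Real.sqrt (h ^ 3) := by
    intro u
    rw [← Finset.sum_mul, Real.sqrt_mul (by positivity), EuclideanSpace.norm_eq,
      Fintype.sum_prod_type]
    simp [S]
  have hST : ∀ w : EuclideanSpace ℝ ({ x // x ∈ Ω } × Fin 3), ‖S (T w)‖ ≤ ‖w‖ := by
    intro w
    rw [EuclideanSpace.norm_eq, EuclideanSpace.norm_eq]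
    refine Real.sqrt_le_sqrt (Finset.sum_le_sum fun p _ => ?_)
    by_cases hx : (p.1 : Pt) ∈ bdry Ω
    · simp only [S, T, hx, if_true]; simp; positivity
    · simp only [S, T, hx, if_false]; exact le_rfl
  have hTU : ∀ w ∈ Metric.closedBall (0 : EuclideanSpace ℝ ({ x // x ∈ Ω } × Fin 3)) (R / Real.sqrt (h ^ 3)), T w ∈ U := by
    intro w hw
    rw [hU]
    refine ⟨?_, ?_⟩
    · rw [hnorm, ← le_div_iff₀ hsq]
      exact (hST w).trans (by simpa using hw)
    · intro x hx
      funext i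
      simp only [T, hx, if_true]; rfl
  have hSU : ∀ u ∈ U, S u ∈ Metric.closedBall (0 : EuclideanSpace ℝ ({ x // x ∈ Ω } × Fin 3)) (R / Real.sqrt (h ^ 3)) := by
    intro u hu
    rw [hU] at hu
    have := hu.1
    rw [hnorm, ← le_div_iff₀ hsq] at this
    simpa using this
  have hTS : ∀ u ∈ U, T (S u) = u := by
    intro u hu
    rw [hU] at hu
    funext x i
    by_cases hx : (x : Pt) ∈ bdry Ω
    · simp only [T, hx, if_true]; rw [hu.2 x hx]; rfl
    · simp only [T, S, hx, if_false]
  obtain ⟨w, hw, hfix⟩ := BrouwerAux.brouwer (E := EuclideanSpace ℝ ({ x // x ∈ Ω } × Fin 3)) (R / Real.sqrt (h ^ 3)) (by positivity)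
    (fun w => S (Φ (T w)))
    (hSc.comp_continuousOn (hcont.comp hTc.continuousOn hTU))
    (fun w hw => hSU _ (hmaps (hTU w hw)))
  refine ⟨T w, hTU w hw, ?_⟩
  have := congrArg T hfix
  rwa [hTS _ (hmaps (hTU w hw))] at this
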